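/- Let A ∈ ℝ^{m×n} satisfy the RIP of order K with constant δ_K ∈ (0, 1), let b ∈ ℝ^m, μ > 0, λ ≥ 0. Suppose x' is a stationary point of r_{μ,λ}(x) + ‖Ax − b‖², i.e. 2z' ∈ ∂g_λ(x') with z' = (I − AᵀA)x' + Aᵀb, that |z'ᵢ| ∉ [(1−δ_K)√μ + λ/2, √μ/(1−δ_K) + λ/2] for every i, and additionally that ‖x'‖₀ < K/2. Then x' minimizes r_{μ,λ}(x) + ‖Ax − b‖² over the set {x ∈ ℝ^n : ‖x‖₀ ≤ K/2}. -/

import Mathlib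

noncomputable section

open scoped BigOperators

open Matrix

/-- ℓ¹ norm -/
def l1 {ι : Type*} [Fintype ι] (x : ι → ℝ) : ℝ := ∑ i, |x i|

/-- ℓ⁰ "norm": the number of nonzero entries of `x` -/
def l0 {ι : Type*} [Fintype ι] (x : ι → ℝ) : ℕ :=
  (Finset.univ.filter fun i => x i ≠ 0).card

/-- squared Euclidean norm -/
def sqnorm {ι : Type*} [Fintype ι] (x : ι → ℝ) : ℝ := ∑ i, (x i) ^ 2

/-- Euclidean inner product -/
def ip {ι : Type*} [Fintype ι] (x y : ι → ℝ) : ℝ := ∑ i, x i * y i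

/-- restricted isometry property of order `K` with constant `δ` -/
def RIP {m n : ℕ} (A : Matrix (Fin m) (Fin n) ℝ) (K : ℕ) (δ : ℝ) : Prop :=
  ∀ x : Fin n → ℝ, l0 x ≤ K →
    (1 - δ) * sqnorm x ≤ sqnorm (A *ᵥ x) ∧ sqnorm (A *ᵥ x) ≤ (1 + δ) * sqnorm x

/-- the regularizer `r_{μ,λ}(x) = Σᵢ (μ − max(√μ − |xᵢ|, 0)²) + λ‖x‖₁` -/
def reg {n : ℕ} (μ lam : ℝ) (x : Fin n → ℝ) : ℝ :=
  (∑ i, (μ - max (Real.sqrt μ - |x i|) 0 ^ 2)) + lam * l1 x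

/-- `g_λ = r_{μ,λ} + ‖·‖²` -/
def gfun {n : ℕ} (μ lam : ℝ) (x : Fin n → ℝ) : ℝ := reg μ lam x + sqnorm x

/-- subdifferential of a convex function on ℝⁿ -/
def subdiff {n : ℕ} (g : (Fin n → ℝ) → ℝ) (x : Fin n → ℝ) : Set (Fin n → ℝ) :=
  {s | ∀ y, g x + ip s (y - x) ≤ g y}


/-- the scalar summand of `g_λ`, with `r = √μ` -/
def gScalar (r lam t : ℝ) : ℝ := r ^ 2 - max (r - |t|) 0 ^ 2 + lam * |t| + t ^ 2

theorem gScalar_neg (r lam t : ℝ) : gScalar r lam (-t) = gScalar r lam t := by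
  simp [gScalar]

theorem gScalar_abs (r lam t : ℝ) : gScalar r lam |t| = gScalar r lam t := by
  simp [gScalar]

theorem gScalar_of_le {r lam t : ℝ} (h0 : 0 ≤ t) (h : t ≤ r) :
    gScalar r lam t = (2 * r + lam) * t := by
  rw [gScalar, abs_of_nonneg h0, max_eq_left (by linarith)]; ring

theorem gScalar_of_ge {r lam t : ℝ} (h0 : 0 ≤ t) (h : r ≤ t) :
    gScalar r lam t = r ^ 2 + lam * t + t ^ 2 := by
  rw [gScalar, abs_of_nonneg h0, max_eq_right (by linarith)]; ring

/-- A subgradient `2z` with small `z` forces the base point to vanish. -/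
theorem eq_zero_of_subgradient {r lam s z : ℝ} (hz : |z| < r + lam / 2)
    (h : gScalar r lam s - 2 * z * s ≤ 0) : s = 0 := by
  by_contra hs
  have hp : 0 < |s| := abs_pos.2 hs
  have hzs : z * s ≤ |z| * |s| := by rw [← abs_mul]; exact le_abs_self _
  have hlt := mul_lt_mul_of_pos_right hz hp
  rw [← gScalar_abs] at h
  rcases le_total |s| r with hr | hr
  · rw [gScalar_of_le hp.le hr] at h
    nlinarith
  · rw [gScalar_of_ge hp.le hr] at h
    nlinarith [sq_nonneg (|s| - r)]

/-- A subgradient `2z` with large `z` is attained at the base point `z - λ/2`. -/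
theorem eq_of_subgradient {r lam s z : ℝ} (hr : 0 < r) (hlam : 0 ≤ lam) (hz : r + lam / 2 < z)
    (h : gScalar r lam s + 2 * z * (z - lam / 2 - s) ≤ gScalar r lam (z - lam / 2)) :
    s = z - lam / 2 := by
  obtain ⟨w, rfl⟩ : ∃ w, z = w + lam / 2 := ⟨z - lam / 2, by ring⟩
  have hw : r < w := by linarith
  rw [add_sub_cancel_right] at h ⊢
  rw [gScalar_of_ge (by linarith) hw.le, ← gScalar_abs] at h
  have hs0 := abs_nonneg s
  have hs : (w + lam / 2) * s ≤ (w + lam / 2) * |s| :=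
    mul_le_mul_of_nonneg_left (le_abs_self s) (by linarith)
  rcases le_total |s| r with hsr | hsr
  · rw [gScalar_of_le hs0 hsr] at h
    nlinarith [mul_pos (sub_pos.2 hw) (show 0 < w + r - 2 * |s| by linarith)]
  · rw [gScalar_of_ge hs0 hsr] at h
    have h1 : (w - |s|) ^ 2 ≤ 0 := by nlinarith
    have h2 : w = |s| := by nlinarith [sq_nonneg (w - |s|)]
    rw [← h2] at h hs
    nlinarith

/-- Away from the critical interval, subgradients of the scalar function satisfy a strong
convexity inequality with modulus `δ`. -/
theorem gScalar_growth_of_nonneg {r lam δ s z : ℝ} (hr : 0 < r) (hlam : 0 ≤ lam) (hδ : 0 < δ)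
    (hδ' : δ < 1) (hz : 0 ≤ z)
    (h : ∀ t, gScalar r lam s + 2 * z * (t - s) ≤ gScalar r lam t)
    (hout : z ∉ Set.Icc ((1 - δ) * r + lam / 2) (r / (1 - δ) + lam / 2)) (t : ℝ) :
    gScalar r lam s + 2 * z * (t - s) + δ * (t - s) ^ 2 ≤ gScalar r lam t := by
  have hz0 : gScalar r lam 0 = 0 := by rw [gScalar_of_le le_rfl hr.le]; ring
  have ht0 := abs_nonneg t
  have hta := le_abs_self t
  rw [← gScalar_abs r lam t]
  by_cases hlow : z < (1 - δ) * r + lam / 2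
  · have h0 := h 0
    rw [hz0] at h0
    obtain rfl : s = 0 := eq_zero_of_subgradient (r := r) (lam := lam) (z := z)
      (by rw [abs_of_nonneg hz]; nlinarith) (by linarith)
    rw [hz0]
    have hzt : z * t ≤ ((1 - δ) * r + lam / 2) * |t| :=
      (mul_le_mul_of_nonneg_left hta hz).trans (mul_le_mul_of_nonneg_right hlow.le ht0)
    have hsq := sq_abs t
    rcases le_total |t| r with htr | htr
    · rw [gScalar_of_le ht0 htr]
      nlinarith [mul_nonneg hδ.le (mul_nonneg ht0 (show 0 ≤ 2 * r - |t| by linarith))]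
    · rw [gScalar_of_ge ht0 htr]
      nlinarith [mul_nonneg (sub_pos.2 hδ').le (sq_nonneg (|t| - r)), mul_pos hδ (pow_pos hr 2)]
  · have hhigh : r / (1 - δ) + lam / 2 < z := by
      by_contra hc
      exact hout ⟨not_lt.1 hlow, not_lt.1 hc⟩
    have h1δ : 0 < 1 - δ := sub_pos.2 hδ'
    have hrs : r < (z - lam / 2) * (1 - δ) := (div_lt_iff₀ h1δ).1 (by linarith)
    have hle : r ≤ r / (1 - δ) := by rw [le_div_iff₀ h1δ]; nlinarith
    have hs := eq_of_subgradient hr hlam (by linarith) (h (z - lam / 2))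
    obtain rfl : z = s + lam / 2 := by linarith
    have hsr : r < s := by linarith
    rw [add_sub_cancel_right] at hrs
    have hs0 : 0 < s := hr.trans hsr
    rw [gScalar_of_ge hs0.le hsr.le]
    have key : r ^ 2 + lam * s + s ^ 2 + 2 * (s + lam / 2) * (|t| - s) + δ * (|t| - s) ^ 2
        ≤ gScalar r lam |t| := by
      rcases le_total |t| r with htr | htr
      · rw [gScalar_of_le ht0 htr]
        have h1 : r - |t| ≤ (1 - δ) * (s - |t|) := by nlinarith
        have h2 : (r - |t|) ^ 2 ≤ (1 - δ) * (s - |t|) ^ 2 := by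
          have := mul_le_mul h1 (show r - |t| ≤ s - |t| by linarith) (by linarith)
            (mul_nonneg h1δ.le (by linarith))
          nlinarith
        nlinarith
      · rw [gScalar_of_ge ht0 htr]
        nlinarith [mul_nonneg h1δ.le (sq_nonneg (|t| - s))]
    have hsq := sq_abs t
    nlinarith [mul_nonneg (mul_nonneg hs0.le h1δ.le) (sub_nonneg.2 hta),
      mul_nonneg hlam (sub_nonneg.2 hta)]

theorem gScalar_growth {r lam δ s z : ℝ} (hr : 0 < r) (hlam : 0 ≤ lam) (hδ : 0 < δ)
    (hδ' : δ < 1) (h : ∀ t, gScalar r lam s + 2 * z * (t - s) ≤ gScalar r lam t)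
    (hout : |z| ∉ Set.Icc ((1 - δ) * r + lam / 2) (r / (1 - δ) + lam / 2)) (t : ℝ) :
    gScalar r lam s + 2 * z * (t - s) + δ * (t - s) ^ 2 ≤ gScalar r lam t := by
  rcases le_total 0 z with hz | hz
  · exact gScalar_growth_of_nonneg hr hlam hδ hδ' hz h (by rwa [abs_of_nonneg hz] at hout) t
  · have := gScalar_growth_of_nonneg (s := -s) (z := -z) hr hlam hδ hδ' (neg_nonneg.2 hz)
      (fun t => by
        have := h (-t)
        rw [gScalar_neg] at this ⊢
        linarith) (by rwa [abs_of_nonpos hz] at hout) (-t)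
    rw [gScalar_neg, gScalar_neg] at this
    linarith

theorem gfun_eq_sum {n : ℕ} {μ : ℝ} (hμ : 0 ≤ μ) (lam : ℝ) (x : Fin n → ℝ) :
    gfun μ lam x = ∑ i, gScalar (Real.sqrt μ) lam (x i) := by
  simp only [gfun, reg, l1, sqnorm, gScalar, Finset.sum_add_distrib, Finset.mul_sum,
    Real.sq_sqrt hμ]

/-- A subgradient of a separable function is a subgradient in each coordinate. -/
theorem subdiff_coordinate {n : ℕ} {g : (Fin n → ℝ) → ℝ} {φ : ℝ → ℝ}
    (hg : ∀ x, g x = ∑ i, φ (x i)) {x u : Fin n → ℝ} (hu : u ∈ subdiff g x) (i : Fin n) (t : ℝ) :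
    φ (x i) + u i * (t - x i) ≤ φ t := by
  have h := hu (Function.update x i t)
  have hip : ip u (Function.update x i t - x) = u i * (t - x i) := by
    rw [ip, Finset.sum_eq_single i]
    · simp
    · intro j _ hj
      simp [Function.update_of_ne hj]
    · simp
  rw [hip, hg, hg, ← Finset.add_sum_erase _ _ (Finset.mem_univ i),
    ← Finset.add_sum_erase _ (fun j => φ (Function.update x i t j)) (Finset.mem_univ i)] at h
  have hrest : ∑ j ∈ Finset.univ.erase i, φ (Function.update x i t j)
      = ∑ j ∈ Finset.univ.erase i, φ (x j) :=
    Finset.sum_congr rfl fun j hj => by rw [Function.update_of_ne (Finset.ne_of_mem_erase hj)]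
  rw [hrest, Function.update_self] at h
  linarith

theorem l0_sub_le {ι : Type*} [Fintype ι] (x y : ι → ℝ) : l0 (x - y) ≤ l0 x + l0 y := by
  classical
  refine (Finset.card_le_card fun i hi => ?_).trans (Finset.card_union_le _ _)
  simp only [Finset.mem_filter, Finset.mem_univ, true_and, Finset.mem_union, Pi.sub_apply] at hi ⊢
  by_contra! hc
  exact hi (by rw [hc.1, hc.2, sub_zero])

theorem sqnorm_eq_dotProduct {ι : Type*} [Fintype ι] (x : ι → ℝ) : sqnorm x = x ⬝ᵥ x := by
  simp [sqnorm, dotProduct, sq]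

theorem ip_eq_dotProduct {ι : Type*} [Fintype ι] (x y : ι → ℝ) : ip x y = x ⬝ᵥ y := rfl

theorem sqnorm_mulVec_sub_expand {m n : ℕ} (A : Matrix (Fin m) (Fin n) ℝ) (b : Fin m → ℝ)
    (x x' : Fin n → ℝ) :
    sqnorm (A *ᵥ x - b) - sqnorm x = sqnorm (A *ᵥ x' - b) - sqnorm x'
      - 2 * ip (x' - Aᵀ *ᵥ (A *ᵥ x') + Aᵀ *ᵥ b) (x - x')
      + sqnorm (A *ᵥ (x - x')) - sqnorm (x - x') := by
  have ht (u : Fin m → ℝ) (v : Fin n → ℝ) : (Aᵀ *ᵥ u) ⬝ᵥ v = u ⬝ᵥ (A *ᵥ v) := by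
    rw [Matrix.mulVec_transpose, Matrix.dotProduct_mulVec]
  simp only [sqnorm_eq_dotProduct, ip_eq_dotProduct, Matrix.mulVec_sub, add_dotProduct,
    sub_dotProduct, dotProduct_sub, ht]
  rw [dotProduct_comm b (A *ᵥ x), dotProduct_comm b (A *ᵥ x'), dotProduct_comm x' x,
    dotProduct_comm (A *ᵥ x') (A *ᵥ x)]
  ring

/-- Theorem 3, second part: a stationary point with `‖x'‖₀ < K/2` minimizes
`r_{μ,λ}(x) + ‖Ax − b‖²` over `{x : ‖x‖₀ ≤ K/2}`. -/
theorem stmt12 {m n : ℕ} (A : Matrix (Fin m) (Fin n) ℝ) (b : Fin m → ℝ)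
    (K : ℕ) (δ : ℝ) (hδ : δ ∈ Set.Ioo (0:ℝ) 1) (hRIP : RIP A K δ)
    (μ lam : ℝ) (hμ : 0 < μ) (hlam : 0 ≤ lam)
    (x' z' : Fin n → ℝ)
    (hz' : z' = x' - Aᵀ *ᵥ (A *ᵥ x') + Aᵀ *ᵥ b)
    (hstat : (2:ℝ) • z' ∈ subdiff (gfun μ lam) x')
    (hout : ∀ i, |z' i| ∉
      Set.Icc ((1 - δ) * Real.sqrt μ + lam / 2) (Real.sqrt μ / (1 - δ) + lam / 2))
    (hsparse : (l0 x' : ℝ) < (K : ℝ) / 2) :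
    ∀ x : Fin n → ℝ, (l0 x : ℝ) ≤ (K : ℝ) / 2 →
      reg μ lam x' + sqnorm (A *ᵥ x' - b) ≤ reg μ lam x + sqnorm (A *ᵥ x - b) := by
  intro x hx
  have hcard : l0 (x - x') ≤ K := by
    have h := l0_sub_le x x'
    have h' : (l0 x : ℝ) + l0 x' ≤ K := by linarith
    exact h.trans (by exact_mod_cast h')
  have hlower := (hRIP (x - x') hcard).1
  have hexp := sqnorm_mulVec_sub_expand A b x x'
  rw [← hz'] at hexp
  have hgrowth : gfun μ lam x' + 2 * ip z' (x - x') + δ * sqnorm (x - x') ≤ gfun μ lam x := by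
    rw [gfun_eq_sum hμ.le, gfun_eq_sum hμ.le, ip, sqnorm, Finset.mul_sum, Finset.mul_sum,
      ← Finset.sum_add_distrib, ← Finset.sum_add_distrib]
    refine Finset.sum_le_sum fun i _ => ?_
    have h := gScalar_growth (Real.sqrt_pos.2 hμ) hlam hδ.1 hδ.2
      (subdiff_coordinate (gfun_eq_sum hμ.le lam) hstat i) (hout i) (x i)
    simpa only [Pi.sub_apply, mul_assoc] using h
  simp only [gfun] at hgrowth
  linarith
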